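/- There exist constants c_1, c_2 > 0 such that for every graph G with m ≥ 2 edges, r(K_3, G) ≥ c_1 · m^{2/3} / (log m)^{2/3}, and for every sufficiently large m there exists a graph G with exactly m edges such that r(K_3, G) ≤ c_2 · m^{2/3} / (log m)^{1/3}. -/

import Mathlib

open SimpleGraph

/-- `G.ContainsCopy H` means the graph `G` contains a subgraph isomorphic to `H`,
i.e. there is an injective graph homomorphism from `H` into `G`. -/
def SimpleGraph.ContainsCopy {α β : Type*} (G : SimpleGraph α) (H : SimpleGraph β) : Prop :=
  ∃ f : H →g G, Function.Injective f

/-- `RamseyProp n H G` : every graph `Γ` on `n` vertices contains a copy of `H`,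
or its complement contains a copy of `G`. -/
def RamseyProp {α β : Type*} (n : ℕ) (H : SimpleGraph α) (G : SimpleGraph β) : Prop :=
  ∀ Γ : SimpleGraph (Fin n), Γ.ContainsCopy H ∨ Γᶜ.ContainsCopy G

/-- The Ramsey number `r(H, G)` : the least positive `n` such that every graph on `n`
vertices contains a copy of `H` or its complement contains a copy of `G`. -/
noncomputable def ramseyNumber {α β : Type*} (H : SimpleGraph α) (G : SimpleGraph β) : ℕ :=
  sInf {n : ℕ | 0 < n ∧ RamseyProp n H G}

theorem sum_card_powerset {V : Type*} [DecidableEq V] (X : Finset V) :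
    2 * ∑ Y ∈ X.powerset, Y.card = X.card * 2 ^ X.card := by
  induction X using Finset.induction_on with
  | empty => simp
  | insert a X ha ih =>
    rw [Finset.sum_powerset_insert ha]
    have h : ∑ Y ∈ X.powerset, (insert a Y).card = ∑ Y ∈ X.powerset, (Y.card + 1) := by
      refine Finset.sum_congr rfl fun Y hY => ?_
      rw [Finset.card_insert_of_notMem fun h => ha (Finset.mem_powerset.1 hY h)]
    rw [h, Finset.sum_add_distrib, Finset.card_insert_of_notMem ha]
    simp only [Finset.sum_const, Finset.card_powerset, smul_eq_mul, mul_one]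
    rw [pow_succ]
    linarith

theorem mul_two_pow_add_one_le {d L : ℕ} (h : 32 ^ L ≤ d) (x : ℕ) :
    2 * (L * (2 ^ x + 1)) ≤ 2 * d + x * 2 ^ x := by
  have h1 : 1 ≤ 2 ^ x := Nat.one_le_two_pow
  rcases le_or_gt (4 * L) x with hx | hx
  · nlinarith [Nat.mul_le_mul_right (2 ^ x) hx, Nat.mul_le_mul_left L h1]
  · have h2 : 2 * 2 ^ x ≤ 16 ^ L := by
      rw [show 16 = 2 ^ 4 by norm_num, ← pow_mul, ← pow_succ']
      exact Nat.pow_le_pow_right (by norm_num) hx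
    have h3 : L ≤ 2 ^ L := Nat.lt_two_pow_self.le
    have h4 : L * 16 ^ L ≤ 32 ^ L := by
      rw [show 32 = 2 * 16 by norm_num, mul_pow]
      exact Nat.mul_le_mul_right _ h3
    nlinarith [Nat.mul_le_mul_left L h2, Nat.mul_le_mul_left L h1]

section Independent

variable {V : Type*} [Fintype V] [DecidableEq V] (Γ : SimpleGraph V) [DecidableRel Γ.Adj]

/-- The independent sets of a finite graph. -/
def indepSets : Finset (Finset V) :=
  Finset.univ.filter fun W => ∀ a ∈ W, ∀ b ∈ W, ¬ Γ.Adj a b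

variable {Γ}

theorem mem_indepSets {W : Finset V} :
    W ∈ indepSets Γ ↔ ∀ a ∈ W, ∀ b ∈ W, ¬ Γ.Adj a b := by
  simp [indepSets]

/-- In a triangle-free graph, the independent sets with a prescribed trace `H` outside the closed
neighbourhood of `v` are `H ∪ {v}` and the sets `H ∪ Y` with `Y` a set of neighbours of `v` that
have no neighbour in `H`. -/
theorem indepSets_fiber (hΓ : ∀ a b c, Γ.Adj a b → Γ.Adj b c → ¬ Γ.Adj a c) (v : V)
    {H : Finset V} (hH : H ∈ indepSets Γ) (hv : v ∉ H) (hN : ∀ a ∈ H, ¬ Γ.Adj v a) :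
    (indepSets Γ).filter (fun W => W \ insert v (Γ.neighborFinset v) = H) =
      insert (insert v H)
        (((Γ.neighborFinset v).filter fun a => ∀ b ∈ H, ¬ Γ.Adj a b).powerset.image
          fun Y => H ∪ Y) := by
  rw [mem_indepSets] at hH
  ext W
  simp only [Finset.mem_filter, mem_indepSets, Finset.mem_insert, Finset.mem_image,
    Finset.mem_powerset]
  constructor
  · rintro ⟨hW, rfl⟩
    by_cases hvW : v ∈ W
    · left
      ext a
      simp only [Finset.mem_insert, Finset.mem_sdiff, mem_neighborFinset]
      have := hW v hvW a
      grind
    · right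
      refine ⟨W ∩ Γ.neighborFinset v, fun a ha => ?_, ?_⟩
      · simp only [Finset.mem_inter, Finset.mem_filter] at ha ⊢
        exact ⟨ha.2, fun b hb => hW a ha.1 b (Finset.mem_sdiff.1 hb).1⟩
      · ext a
        simp only [Finset.mem_union, Finset.mem_insert, Finset.mem_sdiff, Finset.mem_inter]
        grind
  · rintro (rfl | ⟨Y, hY, rfl⟩)
    · constructor
      · intro a ha b hb hab
        rcases Finset.mem_insert.1 ha with ha' | ha' <;>
          rcases Finset.mem_insert.1 hb with hb' | hb'
        · exact hab.ne (ha'.trans hb'.symm)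
        · exact hN b hb' (ha' ▸ hab)
        · exact hN a ha' (hb' ▸ hab.symm)
        · exact hH a ha' b hb' hab
      · ext a
        have := hN a
        simp only [Finset.mem_insert, Finset.mem_sdiff, mem_neighborFinset]
        grind
    · have hY1 : ∀ a ∈ Y, Γ.Adj v a ∧ ∀ b ∈ H, ¬ Γ.Adj a b := fun a ha => by
        simpa using hY ha
      constructor
      · intro a ha b hb hab
        rcases Finset.mem_union.1 ha with ha | ha <;> rcases Finset.mem_union.1 hb with hb | hb
        · exact hH a ha b hb hab
        · exact (hY1 b hb).2 a ha hab.symm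
        · exact (hY1 a ha).2 b hb hab
        · exact hΓ v a b (hY1 a ha).1 hab (hY1 b hb).1
      · ext a
        have := hN a
        have := hY1 a
        simp only [Finset.mem_insert, Finset.mem_sdiff, mem_neighborFinset, Finset.mem_union]
        grind

theorem sum_indepSets_ge (hΓ : ∀ a b c, Γ.Adj a b → Γ.Adj b c → ¬ Γ.Adj a c) {d L : ℕ}
    (hd : 32 ^ L ≤ d) (v : V) :
    L * (indepSets Γ).card ≤
      ∑ W ∈ indepSets Γ, ((if v ∈ W then d else 0) + (Γ.neighborFinset v ∩ W).card) := by
  classical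
  set π : Finset V → Finset V := fun W => W \ insert v (Γ.neighborFinset v) with hπ
  have hmaps : Set.MapsTo π (indepSets Γ) ((indepSets Γ).image π) := fun W hW =>
    Finset.mem_coe.2 (Finset.mem_image_of_mem π hW)
  rw [Finset.card_eq_sum_card_fiberwise hmaps, ← Finset.sum_fiberwise_of_maps_to hmaps,
    Finset.mul_sum]
  refine Finset.sum_le_sum fun H hH => ?_
  obtain ⟨W, hW, rfl⟩ := Finset.mem_image.1 hH
  have hHI : π W ∈ indepSets Γ := mem_indepSets.2 fun a ha b hb =>
    mem_indepSets.1 hW a (Finset.mem_sdiff.1 ha).1 b (Finset.mem_sdiff.1 hb).1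
  have hv : v ∉ π W := by simp [hπ]
  have hN : ∀ a ∈ π W, ¬ Γ.Adj v a := fun a ha => by
    have := (Finset.mem_sdiff.1 ha).2
    simp_all
  have hfib := indepSets_fiber hΓ v hHI hv hN
  rw [show (indepSets Γ).filter (fun W' => π W' = π W) = _ from hfib]
  generalize π W = H at *
  set X := (Γ.neighborFinset v).filter fun a => ∀ b ∈ H, ¬ Γ.Adj a b with hX
  have hXv : ∀ a ∈ X, Γ.Adj v a := fun a ha => by
    simpa using (Finset.mem_filter.1 ha).1
  have hdisj : ∀ Y ∈ X.powerset, Γ.neighborFinset v ∩ (H ∪ Y) = Y := fun Y hY => by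
    ext a
    have := hN a
    have := hXv a
    have : a ∈ Y → a ∈ X := fun h => Finset.mem_powerset.1 hY h
    simp only [Finset.mem_inter, mem_neighborFinset, Finset.mem_union]
    grind
  have hinj : Set.InjOn (fun Y => H ∪ Y) (X.powerset : Set (Finset V)) := fun Y hY Z hZ h => by
    rw [← hdisj Y hY, ← hdisj Z hZ]
    exact congrArg _ h
  have hnot : insert v H ∉ X.powerset.image fun Y => H ∪ Y := by
    intro h
    obtain ⟨Y, hY, h⟩ := Finset.mem_image.1 h
    have hvY : v ∈ H ∪ Y := h ▸ Finset.mem_insert_self v H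
    rcases Finset.mem_union.1 hvY with h | h
    · exact hv h
    · exact (hXv v (Finset.mem_powerset.1 hY h)).ne rfl
  rw [Finset.card_insert_of_notMem hnot, Finset.card_image_of_injOn hinj, Finset.card_powerset,
    Finset.sum_insert hnot, Finset.sum_image hinj]
  have hsum : ∑ Y ∈ X.powerset, Y.card ≤ ∑ Y ∈ X.powerset,
      ((if v ∈ H ∪ Y then d else 0) + (Γ.neighborFinset v ∩ (H ∪ Y)).card) :=
    Finset.sum_le_sum fun Y hY => by rw [hdisj Y hY]; exact Nat.le_add_left _ _
  rw [if_pos (Finset.mem_insert_self v H)]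
  have h1 := mul_two_pow_add_one_le hd X.card
  have h2 := sum_card_powerset X
  omega

/-- A triangle-free graph of maximum degree at most `d` has an independent set of size at least
`|V| L / (2 d)`, where `32 ^ L ≤ d`. -/
theorem exists_indepSet_of_degree_le (hΓ : ∀ a b c, Γ.Adj a b → Γ.Adj b c → ¬ Γ.Adj a c) {d L : ℕ}
    (hd : 32 ^ L ≤ d) (hdeg : ∀ v, Γ.degree v ≤ d) :
    ∃ W ∈ indepSets Γ, Fintype.card V * L ≤ 2 * d * W.card := by
  have hne : (indepSets Γ).Nonempty := ⟨∅, by simp [mem_indepSets]⟩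
  refine Finset.exists_le_of_sum_le hne ?_
  calc ∑ _W ∈ indepSets Γ, Fintype.card V * L
      = ∑ _v : V, L * (indepSets Γ).card := by simp; ring
    _ ≤ ∑ v : V, ∑ W ∈ indepSets Γ,
        ((if v ∈ W then d else 0) + (Γ.neighborFinset v ∩ W).card) :=
        Finset.sum_le_sum fun v _ => sum_indepSets_ge hΓ hd v
    _ = ∑ W ∈ indepSets Γ, ∑ v : V,
        ((if v ∈ W then d else 0) + (Γ.neighborFinset v ∩ W).card) := Finset.sum_comm
    _ ≤ ∑ W ∈ indepSets Γ, 2 * d * W.card := ?_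
  refine Finset.sum_le_sum fun W _ => ?_
  have h : ∑ v : V, (Γ.neighborFinset v ∩ W).card = ∑ w ∈ W, Γ.degree w := by
    calc ∑ v : V, (Γ.neighborFinset v ∩ W).card
        = ∑ v : V, ∑ w ∈ W, if Γ.Adj w v then 1 else 0 := by
          refine Finset.sum_congr rfl fun v _ => ?_
          rw [← Finset.card_filter]
          congr 1
          ext w
          simp [adj_comm, and_comm]
      _ = _ := by
          rw [Finset.sum_comm]
          refine Finset.sum_congr rfl fun w _ => ?_
          rw [← Finset.card_filter, ← card_neighborFinset_eq_degree]
          congr 1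
          ext v
          simp
  have h2 : ∑ w ∈ W, Γ.degree w ≤ W.card * d :=
    Finset.sum_le_card_nsmul _ _ _ fun w _ => hdeg w
  rw [Finset.sum_add_distrib, h]
  simp only [Finset.sum_ite_mem, Finset.univ_inter, Finset.sum_const, smul_eq_mul]
  linarith

end Independent

/-- The bound `r(K₃, Kₖ) = O(k ^ 2 / log k)`. -/
theorem exists_indep_of_triangleFree {V : Type*} [Fintype V] (Γ : SimpleGraph V)
    (hΓ : ∀ a b c, Γ.Adj a b → Γ.Adj b c → ¬ Γ.Adj a c) {k L : ℕ} (hk : 32 ^ L ≤ k)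
    (hV : 2 * k ^ 2 ≤ Fintype.card V * L) :
    ∃ W : Finset V, W.card = k ∧ ∀ a ∈ W, ∀ b ∈ W, ¬ Γ.Adj a b := by
  classical
  suffices h : ∃ W : Finset V, k ≤ W.card ∧ ∀ a ∈ W, ∀ b ∈ W, ¬ Γ.Adj a b by
    obtain ⟨W, hW, hind⟩ := h
    obtain ⟨W', hsub, hcard⟩ := Finset.exists_subset_card_eq hW
    exact ⟨W', hcard, fun a ha b hb => hind a (hsub ha) b (hsub hb)⟩
  by_cases hdeg : ∀ v, Γ.degree v ≤ k
  · obtain ⟨W, hW, h⟩ := exists_indepSet_of_degree_le hΓ hk hdeg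
    refine ⟨W, ?_, mem_indepSets.1 hW⟩
    have hpos : 0 < k := lt_of_lt_of_le (by positivity) hk
    have : 2 * k * k ≤ 2 * k * W.card := by nlinarith
    exact Nat.le_of_mul_le_mul_left this (by positivity)
  · push Not at hdeg
    obtain ⟨v, hv⟩ := hdeg
    refine ⟨Γ.neighborFinset v, ?_, fun a ha b hb hab => ?_⟩
    · rw [card_neighborFinset_eq_degree]
      exact hv.le
    · rw [mem_neighborFinset] at ha hb
      exact hΓ v a b ha hab hb

/-- A triangle-free graph on sufficiently many vertices contains `t` disjoint independent sets of
size `k`. -/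
theorem exists_disjoint_indep {V : Type*} [Fintype V] [DecidableEq V] (Γ : SimpleGraph V)
    (hΓ : ∀ a b c, Γ.Adj a b → Γ.Adj b c → ¬ Γ.Adj a c) {k L n : ℕ} (hk : 32 ^ L ≤ k)
    (hn : 2 * k ^ 2 ≤ n * L) (t : ℕ) (hV : n + t * k ≤ Fintype.card V) :
    ∃ f : Fin t → Finset V, (∀ i, (f i).card = k) ∧
      (∀ i, ∀ a ∈ f i, ∀ b ∈ f i, ¬ Γ.Adj a b) ∧ Pairwise fun i j => Disjoint (f i) (f j) := by
  induction t with
  | zero => exact ⟨fun _ => ∅, fun i => i.elim0, fun i => i.elim0, fun i => i.elim0⟩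
  | succ t ih =>
    obtain ⟨f, hf1, hf2, hf3⟩ := ih (by nlinarith)
    set U : Finset V := (Finset.univ.biUnion f)ᶜ with hU
    have hcU : n ≤ Fintype.card U := by
      have h1 : (Finset.univ.biUnion f).card ≤ t * k := by
        calc _ ≤ ∑ i, (f i).card := Finset.card_biUnion_le
          _ = t * k := by simp [hf1]
      rw [Fintype.card_coe, hU, Finset.card_compl]
      have : t * k ≤ (t + 1) * k := by nlinarith
      omega
    obtain ⟨W, hW, hind⟩ := exists_indep_of_triangleFree (Γ.comap (Subtype.val : U → V))
      (fun a b c => hΓ a b c) hk (hn.trans (Nat.mul_le_mul_right L hcU))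
    have hWU : ∀ a ∈ W.map (Function.Embedding.subtype _), ∀ i, a ∉ f i := by
      intro a ha i hi
      obtain ⟨b, -, rfl⟩ := Finset.mem_map.1 ha
      have hb : (b : V) ∉ Finset.univ.biUnion f := Finset.mem_compl.1 b.2
      exact hb (Finset.mem_biUnion.2 ⟨i, Finset.mem_univ i, hi⟩)
    refine ⟨Fin.cons (W.map (Function.Embedding.subtype _)) f, ?_, ?_, ?_⟩
    · intro i
      refine Fin.cases ?_ (fun i => ?_) i
      · simpa using hW
      · simpa using hf1 i
    · intro i
      refine Fin.cases ?_ (fun i => ?_) i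
      · intro a ha b hb
        simp only [Fin.cons_zero] at ha hb
        obtain ⟨a', ha', rfl⟩ := Finset.mem_map.1 ha
        obtain ⟨b', hb', rfl⟩ := Finset.mem_map.1 hb
        exact hind a' ha' b' hb'
      · simpa using hf2 i
    · intro i j
      refine Fin.cases ?_ (fun i => ?_) i <;> refine Fin.cases ?_ (fun j => ?_) j <;> intro hij
      · exact absurd rfl hij
      · simp only [Fin.cons_zero, Fin.cons_succ]
        exact Finset.disjoint_left.2 fun a ha => hWU a ha j
      · simp only [Fin.cons_zero, Fin.cons_succ]
        exact Finset.disjoint_right.2 fun a ha => hWU a ha i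
      · simp only [Fin.cons_succ]
        exact hf3 fun h => hij (congrArg _ h)

theorem triangleFree_of_not_containsCopy {V : Type*} {Γ : SimpleGraph V}
    (h : ¬ Γ.ContainsCopy (⊤ : SimpleGraph (Fin 3))) (a b c : V) (hab : Γ.Adj a b)
    (hbc : Γ.Adj b c) : ¬ Γ.Adj a c := by
  intro hac
  refine h ⟨⟨![a, b, c], ?_⟩, ?_⟩
  · intro i j hij
    fin_cases i <;> fin_cases j <;> simp_all [adj_comm]
  · have h1 := hab.ne
    have h2 := hbc.ne
    have h3 := hac.ne
    intro i j hij
    fin_cases i <;> fin_cases j <;> simp_all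

theorem not_containsCopy_of_triangleFree {V : Type*} {Γ : SimpleGraph V}
    (h : ∀ a b c, Γ.Adj a b → Γ.Adj b c → ¬ Γ.Adj a c) :
    ¬ Γ.ContainsCopy (⊤ : SimpleGraph (Fin 3)) := by
  rintro ⟨f, -⟩
  exact h (f 0) (f 1) (f 2) (f.map_adj (by simp)) (f.map_adj (by simp)) (f.map_adj (by simp))

theorem exists_ramseyProp {β : Type*} [Fintype β] (G : SimpleGraph β) :
    ∃ n, 0 < n ∧ RamseyProp n (⊤ : SimpleGraph (Fin 3)) G := by
  classical
  refine ⟨2 * (Fintype.card β + 32) ^ 2, by positivity, fun Γ => or_iff_not_imp_left.2 fun h => ?_⟩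
  obtain ⟨W, hW, hind⟩ := exists_indep_of_triangleFree Γ (triangleFree_of_not_containsCopy h)
    (k := Fintype.card β + 32) (L := 1) (by omega) (by simp)
  have hcard : Fintype.card β ≤ Fintype.card W := by rw [Fintype.card_coe]; omega
  obtain ⟨e⟩ := Function.Embedding.nonempty_of_card_le hcard
  refine ⟨⟨fun x => (e x : Fin _), fun {a b} hab => ?_⟩, fun a b hab => ?_⟩
  · rw [compl_adj]
    exact ⟨fun h => hab.ne (e.injective (Subtype.ext h)), hind _ (e a).2 _ (e b).2⟩
  · exact e.injective (Subtype.ext hab)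

theorem RamseyProp.mono {α β : Type*} {H : SimpleGraph α} {G : SimpleGraph β} {m n : ℕ}
    (h : RamseyProp m H G) (hmn : m ≤ n) : RamseyProp n H G := by
  intro Γ
  rcases h (Γ.comap (Fin.castLE hmn)) with ⟨f, hf⟩ | ⟨f, hf⟩
  · exact Or.inl ⟨⟨fun x => Fin.castLE hmn (f x), fun hab => f.map_adj hab⟩,
      fun a b hab => hf (Fin.castLE_injective hmn hab)⟩
  · refine Or.inr ⟨⟨fun x => Fin.castLE hmn (f x), fun {a b} hab => ?_⟩,
      fun a b hab => hf (Fin.castLE_injective hmn hab)⟩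
    have := f.map_adj hab
    rw [compl_adj] at this ⊢
    exact ⟨fun h => this.1 (Fin.castLE_injective hmn h), this.2⟩

theorem lt_ramseyNumber {β : Type*} [Fintype β] {G : SimpleGraph β} {n : ℕ}
    (h : ¬ RamseyProp n (⊤ : SimpleGraph (Fin 3)) G) :
    n < ramseyNumber (⊤ : SimpleGraph (Fin 3)) G := by
  by_contra! hle
  have hmem : ramseyNumber (⊤ : SimpleGraph (Fin 3)) G ∈
      {n : ℕ | 0 < n ∧ RamseyProp n (⊤ : SimpleGraph (Fin 3)) G} :=
    Nat.sInf_mem (exists_ramseyProp G)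
  exact h (hmem.2.mono hle)

/-- The disjoint union of `t` cliques of size `k`. -/
def cliqueUnion (t k : ℕ) : SimpleGraph (Fin t × Fin k) where
  Adj x y := x.1 = y.1 ∧ x ≠ y
  symm := ⟨fun _ _ h => ⟨h.1.symm, h.2.symm⟩⟩
  loopless := ⟨fun _ h => h.2 rfl⟩

theorem two_mul_ncard_edgeSet_cliqueUnion (t k : ℕ) :
    2 * (cliqueUnion t k).edgeSet.ncard = t * k * (k - 1) := by
  classical
  have hdeg : ∀ x, (cliqueUnion t k).degree x = k - 1 := by
    intro x
    have : (cliqueUnion t k).neighborFinset x = {x.1} ×ˢ Finset.univ.erase x.2 := by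
      ext y
      rw [mem_neighborFinset]
      simp only [cliqueUnion, Finset.mem_product, Finset.mem_singleton, Finset.mem_erase,
        Finset.mem_univ, and_true, Ne, Prod.ext_iff]
      grind
    rw [← card_neighborFinset_eq_degree, this]
    simp
  have h := (cliqueUnion t k).sum_degrees_eq_twice_card_edges
  rw [← coe_edgeFinset, Set.ncard_coe_finset, ← h]
  simp [hdeg]

theorem ramseyProp_of_le_cliqueUnion {k L n t : ℕ} (hk : 32 ^ L ≤ k) (hn : 2 * k ^ 2 ≤ n * L)
    {G : SimpleGraph (Fin t × Fin k)} (hG : G ≤ cliqueUnion t k) :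
    RamseyProp (n + t * k) (⊤ : SimpleGraph (Fin 3)) G := by
  refine fun Γ => or_iff_not_imp_left.2 fun h => ?_
  obtain ⟨f, hf1, hf2, hf3⟩ := exists_disjoint_indep Γ (triangleFree_of_not_containsCopy h) hk hn t
    (by simp)
  have hinj : Function.Injective fun x : Fin t × Fin k => (f x.1).orderEmbOfFin (hf1 x.1) x.2 := by
    rintro ⟨i, a⟩ ⟨j, b⟩ hij
    simp only at hij
    by_cases h : i = j
    · subst h
      simpa using hij
    · have h1 := Finset.orderEmbOfFin_mem (f i) (hf1 i) a
      have h2 := Finset.orderEmbOfFin_mem (f j) (hf1 j) b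
      rw [hij] at h1
      exact absurd h2 (Finset.disjoint_left.1 (hf3 h) h1)
  refine ⟨⟨_, fun {x y} hxy => ?_⟩, hinj⟩
  obtain ⟨h1, h2⟩ := hG hxy
  rw [compl_adj]
  refine ⟨fun h => h2 (hinj h), hf2 x.1 _ (Finset.orderEmbOfFin_mem _ (hf1 x.1) x.2) _ ?_⟩
  rw [h1]
  exact Finset.orderEmbOfFin_mem _ (hf1 y.1) y.2

theorem exists_ramseyNumber_le {k L n t m : ℕ} (hk : 32 ^ L ≤ k) (hn : 2 * k ^ 2 ≤ n * L)
    (hm : 2 * m ≤ t * k * (k - 1)) :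
    ∃ G : SimpleGraph (Fin t × Fin k), G.edgeSet.ncard = m ∧
      ramseyNumber (⊤ : SimpleGraph (Fin 3)) G ≤ n + t * k := by
  have hk0 : 0 < k := lt_of_lt_of_le (by positivity) hk
  have hn0 : 0 < n := Nat.pos_of_ne_zero fun h => by
    subst h
    have : 0 < k ^ 2 := by positivity
    omega
  obtain ⟨s, hs, hcard⟩ := Set.exists_subset_card_eq
    (s := (cliqueUnion t k).edgeSet) (n := m)
    (by have := two_mul_ncard_edgeSet_cliqueUnion t k; omega)
  have hle : fromEdgeSet s ≤ cliqueUnion t k := by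
    intro x y hxy
    exact hs ((fromEdgeSet_adj s).1 hxy).1
  refine ⟨fromEdgeSet s, ?_, Nat.sInf_le ⟨by omega, ramseyProp_of_le_cliqueUnion hk hn hle⟩⟩
  rw [edgeSet_fromEdgeSet, sdiff_eq_left.2, hcard]
  exact Set.disjoint_left.2 fun e he hd => not_isDiag_of_mem_edgeSet _ (hs he) hd

theorem exists_cliqueUnion_parameters {m : ℕ} (hm : 2 ^ 15 ≤ m) :
    ∃ k L n t : ℕ, 32 ^ L ≤ k ∧ 2 * k ^ 2 ≤ n * L ∧ 2 * m ≤ t * k * (k - 1) ∧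
      (n + t * k) * L ≤ 8 * k ^ 2 ∧ k ^ 3 ≤ 8 * (m * L) ∧ 1 ≤ L ∧ m < 2 ^ (30 * L) := by
  set L := Nat.log 2 m / 15 with hL
  have hm0 : m ≠ 0 := by omega
  have hlog : 15 ≤ Nat.log 2 m := Nat.le_log_of_pow_le (by norm_num) hm
  have hL1 : 1 ≤ L := by omega
  have hex : ∃ k, m * L ≤ k ^ 3 := ⟨m * L, Nat.le_self_pow (by norm_num) _⟩
  classical
  set k := Nat.find hex with hkdef
  have hk : m * L ≤ k ^ 3 := Nat.find_spec hex
  have hmL : m ≤ m * L := Nat.le_mul_of_pos_right m hL1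
  have hk2 : 2 ≤ k := by
    by_contra! h
    have : k ^ 3 ≤ 1 ^ 3 := Nat.pow_le_pow_left (by omega) 3
    omega
  have hk1 : (k - 1) ^ 3 < m * L := not_le.1 (Nat.find_min hex (by omega))
  have h32 : 32 ^ L ≤ k := by
    refine (Nat.pow_le_pow_iff_left (n := 3) (by norm_num)).1 ?_
    calc (32 ^ L) ^ 3 = 2 ^ (15 * L) := by
          rw [show 32 = 2 ^ 5 by norm_num, ← pow_mul, ← pow_mul]; congr 1; ring
      _ ≤ 2 ^ Nat.log 2 m := Nat.pow_le_pow_right (by norm_num) (by omega)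
      _ ≤ m := Nat.pow_log_le_self 2 hm0
      _ ≤ k ^ 3 := hmL.trans hk
  have hLk : L ≤ k := (Nat.lt_pow_self (by norm_num : 1 < 32)).le.trans h32
  obtain ⟨j, hj⟩ : ∃ j, k = j + 2 := ⟨k - 2, by omega⟩
  have hsub : k - 1 = j + 1 := by omega
  rw [hsub] at hk1
  have hn1 := Nat.div_add_mod (2 * k ^ 2) L
  have hn2 := Nat.mod_lt (2 * k ^ 2) hL1
  have hpos : 0 < k * (j + 1) := by positivity
  have ht1 := Nat.div_add_mod (2 * m) (k * (j + 1))
  have ht2 := Nat.mod_lt (2 * m) hpos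
  refine ⟨k, L, 2 * k ^ 2 / L + 1, 2 * m / (k * (j + 1)) + 1, h32, ?_, ?_, ?_, ?_, hL1, ?_⟩
  · nlinarith
  · rw [hsub]
    nlinarith
  · have h1 : 2 * k ^ 2 / L * L ≤ 2 * k ^ 2 := Nat.div_mul_le_self _ _
    have h2 : 2 * m / (k * (j + 1)) * (k * (j + 1)) ≤ 2 * m := Nat.div_mul_le_self _ _
    generalize 2 * k ^ 2 / L = a at h1 ⊢
    generalize 2 * m / (k * (j + 1)) = b at h2 ⊢
    have h3 : (b * k * L) * (j + 1) ≤ (4 * k ^ 2) * (j + 1) := by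
      calc (b * k * L) * (j + 1) = b * (k * (j + 1)) * L := by ring
        _ ≤ 2 * m * L := Nat.mul_le_mul_right L h2
        _ ≤ 2 * k ^ 3 := by nlinarith
        _ = k ^ 2 * (2 * k) := by ring
        _ ≤ k ^ 2 * (4 * (j + 1)) := Nat.mul_le_mul_left _ (by omega)
        _ = _ := by ring
    have h4 := Nat.le_of_mul_le_mul_right h3 (by omega)
    have h5 : k * L ≤ k ^ 2 := by rw [pow_two]; exact Nat.mul_le_mul_left k hLk
    have h6 : k ≤ k ^ 2 := Nat.le_self_pow (by norm_num) k
    calc (a + 1 + (b + 1) * k) * L = a * L + L + b * k * L + k * L := by ring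
      _ ≤ 8 * k ^ 2 := by omega
  · calc k ^ 3 ≤ (2 * (j + 1)) ^ 3 := Nat.pow_le_pow_left (by omega) 3
      _ = 8 * (j + 1) ^ 3 := by ring
      _ ≤ _ := by omega
  · calc m < 2 ^ (Nat.log 2 m + 1) := Nat.lt_pow_succ_log_self (by norm_num) m
      _ ≤ 2 ^ (30 * L) := Nat.pow_le_pow_right (by norm_num) (by omega)

theorem exists_graph_ramseyNumber_le {m : ℕ} (hm : 2 ^ 15 ≤ m) :
    ∃ (β : Type) (_ : Fintype β) (G : SimpleGraph β), G.edgeSet.ncard = m ∧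
      (ramseyNumber (⊤ : SimpleGraph (Fin 3)) G : ℝ) ≤
        128 * (m : ℝ) ^ ((2 : ℝ) / 3) / Real.log m ^ ((1 : ℝ) / 3) := by
  obtain ⟨k, L, n, t, hk, hn, hmt, hN, hk3, hL, hlog⟩ := exists_cliqueUnion_parameters hm
  obtain ⟨G, hG, hr⟩ := exists_ramseyNumber_le hk hn hmt
  refine ⟨_, inferInstance, G, hG, ?_⟩
  have hr' : (ramseyNumber (⊤ : SimpleGraph (Fin 3)) G : ℝ) ≤ ((n + t * k : ℕ) : ℝ) := by
    exact_mod_cast hr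
  refine hr'.trans ?_
  have hN' : ((n + t * k : ℕ) : ℝ) * L ≤ 8 * k ^ 2 := by exact_mod_cast hN
  have hm1 : (1 : ℝ) < m := by
    have : 1 < m := lt_of_lt_of_le (by norm_num) hm
    exact_mod_cast this
  have hlogpos : 0 < Real.log m := Real.log_pos hm1
  have hlogle : Real.log m ≤ 30 * L := by
    calc Real.log m ≤ Real.log ((2 : ℝ) ^ (30 * L)) :=
          Real.log_le_log (by linarith) (by exact_mod_cast hlog.le)
      _ = 30 * L * Real.log 2 := by rw [Real.log_pow]; push_cast; ring
      _ ≤ 30 * L * 1 := by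
          gcongr
          linarith [Real.log_two_lt_d9]
      _ = 30 * L := mul_one _
  have hL' : (0 : ℝ) < L := by exact_mod_cast hL
  have hcube : ∀ y : ℝ, 0 < y → (y ^ ((1 : ℝ) / 3)) ^ 3 = y := fun y hy => by
    rw [← Real.rpow_natCast, ← Real.rpow_mul hy.le]
    norm_num
  have hA : (m : ℝ) ^ ((2 : ℝ) / 3) = ((m : ℝ) ^ ((1 : ℝ) / 3)) ^ 2 := by
    rw [← Real.rpow_natCast, ← Real.rpow_mul (by linarith)]
    norm_num
  rw [hA]
  have hx := hcube m (by linarith)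
  have hy := hcube L hL'
  have hz := hcube _ hlogpos
  have hx0 : 0 < (m : ℝ) ^ ((1 : ℝ) / 3) := by positivity
  have hy0 : 0 < (L : ℝ) ^ ((1 : ℝ) / 3) := by positivity
  have hz0 : 0 < Real.log m ^ ((1 : ℝ) / 3) := by positivity
  have hk3' : (k : ℝ) ^ 3 ≤ 8 * (m * L) := by exact_mod_cast hk3
  generalize (m : ℝ) ^ ((1 : ℝ) / 3) = x at *
  generalize (L : ℝ) ^ ((1 : ℝ) / 3) = y at *
  generalize Real.log m ^ ((1 : ℝ) / 3) = z at *
  have h1 : (k : ℝ) ≤ 2 * x * y := by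
    refine le_of_pow_le_pow_left₀ (n := 3) (by norm_num) (by positivity) ?_
    calc (k : ℝ) ^ 3 ≤ 8 * (m * L) := hk3'
      _ = (2 * x * y) ^ 3 := by rw [← hx, ← hy]; ring
  have h2 : z ≤ 4 * y := by
    refine le_of_pow_le_pow_left₀ (n := 3) (by norm_num) (by positivity) ?_
    calc z ^ 3 ≤ 30 * L := by rw [hz]; exact hlogle
      _ ≤ (4 * y) ^ 3 := by rw [← hy]; nlinarith [pow_pos hy0 3]
  rw [le_div_iff₀ hz0]
  have h3 : ((n + t * k : ℕ) : ℝ) * y ^ 3 ≤ 8 * (2 * x * y) ^ 2 := by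
    rw [hy]
    refine hN'.trans ?_
    gcongr
  have h4 : ((n + t * k : ℕ) : ℝ) * y ≤ 32 * x ^ 2 := by
    refine le_of_mul_le_mul_right ?_ (pow_pos hy0 2)
    linarith
  have h5 : ((n + t * k : ℕ) : ℝ) * z ≤ ((n + t * k : ℕ) : ℝ) * (4 * y) := by gcongr
  linarith

theorem sum_biUnion_le {ι α : Type*} [DecidableEq α] (s : Finset ι) (t : ι → Finset α) {f : α → ℝ}
    (hf : ∀ a, 0 ≤ f a) : ∑ a ∈ s.biUnion t, f a ≤ ∑ i ∈ s, ∑ a ∈ t i, f a := by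
  classical
  induction s using Finset.induction_on with
  | empty => simp
  | insert i s hi ih =>
    rw [Finset.biUnion_insert, Finset.sum_insert hi]
    have h := Finset.sum_union_inter (s₁ := t i) (s₂ := s.biUnion t) (f := f)
    have h' : 0 ≤ ∑ a ∈ t i ∩ s.biUnion t, f a := Finset.sum_nonneg fun a _ => hf a
    linarith

section RandomSubset

variable {E : Type*} [Fintype E] [DecidableEq E] {p : ℝ}

/-- The probability of `A` when a subset of `E` is chosen by including each element independently
with probability `p`. -/
noncomputable def binomialWeight (p : ℝ) (A : Finset E) : ℝ := p ^ A.card * (1 - p) ^ Aᶜ.card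

theorem binomialWeight_nonneg (h0 : 0 ≤ p) (h1 : p ≤ 1) (A : Finset E) :
    0 ≤ binomialWeight p A :=
  mul_nonneg (pow_nonneg h0 _) (pow_nonneg (by linarith) _)

theorem sum_binomialWeight_mul_prod (x y : E → ℝ) :
    ∑ A : Finset E, binomialWeight p A * ((∏ e ∈ A, x e) * ∏ e ∈ Aᶜ, y e) =
      ∏ e, (p * x e + (1 - p) * y e) := by
  rw [Fintype.prod_add]
  refine Finset.sum_congr rfl fun A _ => ?_
  rw [Finset.prod_mul_distrib, Finset.prod_mul_distrib, Finset.prod_const, Finset.prod_const,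
    binomialWeight]
  ring

variable (E) in
theorem sum_binomialWeight : ∑ A : Finset E, binomialWeight p A = 1 := by
  simpa using sum_binomialWeight_mul_prod (E := E) (p := p) 1 1

theorem sum_binomialWeight_superset (T : Finset E) :
    ∑ A : Finset E with T ⊆ A, binomialWeight p A = p ^ T.card := by
  have h := sum_binomialWeight_mul_prod (p := p) 1 fun e => if e ∈ T then 0 else 1
  have h1 : ∏ e : E, (p * (1 : E → ℝ) e + (1 - p) * if e ∈ T then 0 else 1) = p ^ T.card := by
    rw [← Finset.prod_const, ← Finset.prod_subset (Finset.subset_univ T)]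
    · exact Finset.prod_congr rfl fun e he => by simp [he]
    · intro e _ he
      simp [he]
  rw [← h1, ← h, Finset.sum_filter]
  refine Finset.sum_congr rfl fun A _ => ?_
  split_ifs with hA
  · have hone : ∏ e ∈ Aᶜ, (if e ∈ T then (0 : ℝ) else 1) = 1 :=
      Finset.prod_eq_one fun e he => if_neg fun h => Finset.mem_compl.1 he (hA h)
    simp [hone]
  · obtain ⟨e, he, heA⟩ := Finset.not_subset.1 hA
    have hzero : ∏ e ∈ Aᶜ, (if e ∈ T then (0 : ℝ) else 1) = 0 :=
      Finset.prod_eq_zero (Finset.mem_compl.2 heA) (if_pos he)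
    rw [hzero]
    ring

theorem sum_binomialWeight_card_inter_le (h0 : 0 ≤ p) (h1 : p ≤ 1) (S : Finset E) (r : ℕ) :
    ∑ A : Finset E with (S ∩ A).card ≤ r, binomialWeight p A ≤ 2 ^ r * (1 - p / 2) ^ S.card := by
  have h := sum_binomialWeight_mul_prod (p := p) (fun e => if e ∈ S then 2⁻¹ else 1) 1
  have hS : ∏ e : E, (p * (if e ∈ S then 2⁻¹ else 1) + (1 - p) * (1 : E → ℝ) e) =
      (1 - p / 2) ^ S.card := by
    rw [← Finset.prod_const, ← Finset.prod_subset (Finset.subset_univ S)]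
    · exact Finset.prod_congr rfl fun e he => by simp [he]; ring
    · intro e _ he
      simp [he]
  rw [← hS, ← h, Finset.sum_filter, Finset.mul_sum]
  refine Finset.sum_le_sum fun A _ => ?_
  have hprod : (∏ e ∈ A, if e ∈ S then (2⁻¹ : ℝ) else 1) * ∏ e ∈ Aᶜ, (1 : E → ℝ) e =
      2⁻¹ ^ (S ∩ A).card := by
    rw [Finset.prod_ite, Finset.prod_const, Finset.filter_mem_eq_inter, Finset.inter_comm]
    simp
  rw [hprod]
  have hw := binomialWeight_nonneg h0 h1 A
  split_ifs with hA
  · have : (1 : ℝ) ≤ 2 ^ r * 2⁻¹ ^ (S ∩ A).card := by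
      rw [inv_pow, ← div_eq_mul_inv, one_le_div (by positivity)]
      exact pow_le_pow_right₀ (by norm_num) hA
    nlinarith
  · positivity

open scoped Classical in
theorem sum_binomialWeight_disjoint_le (h0 : 0 ≤ p) (h1 : p ≤ 1) {𝒯 : Finset (Finset E)}
    (h3 : ∀ T ∈ 𝒯, T.card = 3) (t : ℕ) :
    ∑ A : Finset E with ∃ 𝓕 ⊆ 𝒯, 𝓕.card = t ∧ (𝓕 : Set (Finset E)).PairwiseDisjoint id ∧
      𝓕.biUnion id ⊆ A, binomialWeight p A ≤ 𝒯.card.choose t * p ^ (3 * t) := by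
  set 𝒬 := (𝒯.powersetCard t).filter fun 𝓕 : Finset (Finset E) =>
    (𝓕 : Set (Finset E)).PairwiseDisjoint id with h𝒬
  calc _ ≤ ∑ A ∈ 𝒬.biUnion fun 𝓕 => Finset.univ.filter fun A => 𝓕.biUnion id ⊆ A,
        binomialWeight p A := by
        refine Finset.sum_le_sum_of_subset_of_nonneg (fun A hA => ?_) fun A _ _ =>
          binomialWeight_nonneg h0 h1 A
        obtain ⟨𝓕, hsub, hcard, hdisj, hA⟩ := (Finset.mem_filter.1 hA).2
        exact Finset.mem_biUnion.2 ⟨𝓕, Finset.mem_filter.2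
          ⟨Finset.mem_powersetCard.2 ⟨hsub, hcard⟩, hdisj⟩, by simpa using hA⟩
    _ ≤ ∑ 𝓕 ∈ 𝒬, ∑ A : Finset E with 𝓕.biUnion id ⊆ A, binomialWeight p A :=
        sum_biUnion_le _ _ fun A => binomialWeight_nonneg h0 h1 A
    _ = ∑ 𝓕 ∈ 𝒬, p ^ (3 * t) := by
        refine Finset.sum_congr rfl fun 𝓕 h𝓕 => ?_
        obtain ⟨h, hdisj⟩ := Finset.mem_filter.1 h𝓕
        obtain ⟨hsub, hcard⟩ := Finset.mem_powersetCard.1 h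
        have hsum : ∑ T ∈ 𝓕, (id T).card = 3 * t := by
          rw [Finset.sum_const_nat (m := 3) (f := fun T => (id T).card)
            fun T hT => h3 T (hsub hT), hcard, mul_comm]
        rw [sum_binomialWeight_superset, Finset.card_biUnion hdisj, hsum]
    _ = 𝒬.card * p ^ (3 * t) := by simp
    _ ≤ 𝒯.card.choose t * p ^ (3 * t) := by
        gcongr
        rw [← Finset.card_powersetCard]
        exact Finset.card_filter_le _ _

/-- Deleting a maximal family of disjoint members of `𝒯` from `A` leaves a set that contains no
member of `𝒯` and still meets `S`, if `A ∩ S` is large and `A` contains few disjoint members of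
`𝒯` meeting `S`. -/
theorem exists_subset_hitting {𝒯 𝓢 : Finset (Finset E)} (h3 : ∀ T ∈ 𝒯, T.card = 3) {t : ℕ}
    {A : Finset E} (hA : ∀ S ∈ 𝓢, 3 * t < (S ∩ A).card)
    (hA' : ∀ S ∈ 𝓢, ∀ 𝓕 ⊆ 𝒯.filter (fun T => (T ∩ S).Nonempty), 𝓕.card = t →
      (𝓕 : Set (Finset E)).PairwiseDisjoint id → ¬ 𝓕.biUnion id ⊆ A) :
    ∃ B : Finset E, (∀ T ∈ 𝒯, ¬ T ⊆ B) ∧ ∀ S ∈ 𝓢, (S ∩ B).Nonempty := by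
  classical
  set 𝒬 := 𝒯.powerset.filter fun 𝓕 : Finset (Finset E) => (𝓕 : Set (Finset E)).PairwiseDisjoint id ∧
    𝓕.biUnion id ⊆ A with h𝒬
  obtain ⟨𝓜, h𝓜, hmax⟩ := Finset.exists_max_image 𝒬 Finset.card ⟨∅, by simp [h𝒬]⟩
  obtain ⟨hsub, hdisj, hin⟩ : 𝓜 ⊆ 𝒯 ∧ (𝓜 : Set (Finset E)).PairwiseDisjoint id ∧
      𝓜.biUnion id ⊆ A := by simpa [h𝒬] using h𝓜
  refine ⟨A \ 𝓜.biUnion id, fun T hT hTB => ?_, fun S hS => ?_⟩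
  · obtain ⟨hTA, hTd⟩ := Finset.subset_sdiff.1 hTB
    have hTd' : ∀ T' ∈ 𝓜, Disjoint T T' := by
      simpa [Finset.disjoint_biUnion_right] using hTd
    have hT𝓜 : T ∉ 𝓜 := fun h => by
      have hT3 := h3 T hT
      have hTe : T = ∅ := (Finset.disjoint_self_iff_empty T).1 (hTd' T h)
      simp [hTe] at hT3
    have h := hmax (insert T 𝓜) (Finset.mem_filter.2 ⟨Finset.mem_powerset.2
      (Finset.insert_subset hT hsub), ?_, ?_⟩)
    · rw [Finset.card_insert_of_notMem hT𝓜] at h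
      omega
    · rw [Finset.coe_insert]
      exact hdisj.insert fun T' hT' _ => hTd' T' hT'
    · rw [Finset.biUnion_insert]
      exact Finset.union_subset hTA hin
  · by_contra hne
    rw [Finset.not_nonempty_iff_eq_empty] at hne
    set 𝓝 := 𝓜.filter fun T => (T ∩ S).Nonempty with h𝓝
    have hcover : S ∩ A ⊆ 𝓝.biUnion id := by
      intro e he
      obtain ⟨heS, heA⟩ := Finset.mem_inter.1 he
      have he' : e ∈ 𝓜.biUnion id := by
        by_contra h
        have : e ∈ S ∩ (A \ 𝓜.biUnion id) :=
          Finset.mem_inter.2 ⟨heS, Finset.mem_sdiff.2 ⟨heA, h⟩⟩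
        simp [hne] at this
      obtain ⟨T, hT, heT⟩ := Finset.mem_biUnion.1 he'
      exact Finset.mem_biUnion.2 ⟨T, Finset.mem_filter.2 ⟨hT, e, Finset.mem_inter.2 ⟨heT, heS⟩⟩,
        heT⟩
    have hcard : (S ∩ A).card ≤ 𝓝.card * 3 := (Finset.card_le_card hcover).trans
      (Finset.card_biUnion_le_card_mul _ _ _ fun T hT =>
        (h3 T (hsub (Finset.mem_filter.1 hT).1)).le)
    have h1 := hA S hS
    obtain ⟨𝓕, h𝓕, h𝓕t⟩ := Finset.exists_subset_card_eq (show t ≤ 𝓝.card by omega)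
    have h𝓕𝓜 : 𝓕 ⊆ 𝓜 := h𝓕.trans (Finset.filter_subset _ _)
    refine hA' S hS 𝓕 (h𝓕.trans (Finset.filter_subset_filter _ hsub)) h𝓕t
      (hdisj.subset (Finset.coe_subset.2 h𝓕𝓜)) ?_
    exact (Finset.biUnion_subset_biUnion_of_subset_left _ h𝓕𝓜).trans hin

theorem exists_hitting (h0 : 0 ≤ p) (h1 : p ≤ 1) {𝒯 𝓢 : Finset (Finset E)}
    (h3 : ∀ T ∈ 𝒯, T.card = 3) {D m t : ℕ} (hD : ∀ e, (𝒯.filter fun T => e ∈ T).card ≤ D)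
    (hm : ∀ S ∈ 𝓢, S.card = m)
    (hlt : 𝓢.card * (2 ^ (3 * t) * (1 - p / 2) ^ m + (m * D).choose t * p ^ (3 * t)) < 1) :
    ∃ B : Finset E, (∀ T ∈ 𝒯, ¬ T ⊆ B) ∧ ∀ S ∈ 𝓢, (S ∩ B).Nonempty := by
  classical
  set bad₁ : Finset E → Finset (Finset E) := fun S =>
    Finset.univ.filter fun A => (S ∩ A).card ≤ 3 * t with hbad₁
  set bad₂ : Finset E → Finset (Finset E) := fun S => Finset.univ.filter fun A =>
    ∃ 𝓕 ⊆ 𝒯.filter (fun T => (T ∩ S).Nonempty), 𝓕.card = t ∧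
      (𝓕 : Set (Finset E)).PairwiseDisjoint id ∧ 𝓕.biUnion id ⊆ A with hbad₂
  have hw := fun A : Finset E => binomialWeight_nonneg h0 h1 A
  have hbad : ∑ A ∈ 𝓢.biUnion fun S => bad₁ S ∪ bad₂ S, binomialWeight p A < 1 := by
    refine lt_of_le_of_lt ?_ hlt
    calc _ ≤ ∑ S ∈ 𝓢, ∑ A ∈ bad₁ S ∪ bad₂ S, binomialWeight p A :=
          sum_biUnion_le _ _ fun A => hw A
      _ ≤ ∑ S ∈ 𝓢, (2 ^ (3 * t) * (1 - p / 2) ^ m + (m * D).choose t * p ^ (3 * t)) := by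
          refine Finset.sum_le_sum fun S hS => ?_
          have hcard : (𝒯.filter fun T => (T ∩ S).Nonempty).card ≤ m * D := by
            rw [← hm S hS]
            refine (Finset.card_le_card fun T hT => ?_).trans
              (Finset.card_biUnion_le_card_mul S (fun e => 𝒯.filter fun T => e ∈ T) D
                fun e _ => hD e)
            obtain ⟨hT, e, he⟩ := Finset.mem_filter.1 hT
            obtain ⟨heT, heS⟩ := Finset.mem_inter.1 he
            exact Finset.mem_biUnion.2 ⟨e, heS, Finset.mem_filter.2 ⟨hT, heT⟩⟩
          have hb₁ := sum_binomialWeight_card_inter_le h0 h1 S (3 * t)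
          have hb₂ := sum_binomialWeight_disjoint_le h0 h1
            (𝒯 := 𝒯.filter fun T => (T ∩ S).Nonempty)
            (fun T hT => h3 T (Finset.mem_filter.1 hT).1) t
          rw [hm S hS] at hb₁
          have hch : ((𝒯.filter fun T => (T ∩ S).Nonempty).card.choose t : ℝ) * p ^ (3 * t) ≤
              (m * D).choose t * p ^ (3 * t) := by
            gcongr
          have hun := Finset.sum_union_inter (s₁ := bad₁ S) (s₂ := bad₂ S)
            (f := binomialWeight p)
          have hin : 0 ≤ ∑ A ∈ bad₁ S ∩ bad₂ S, binomialWeight p A :=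
            Finset.sum_nonneg fun A _ => hw A
          simp only [hbad₁, hbad₂] at hun hin ⊢
          linarith
      _ = _ := by rw [Finset.sum_const, nsmul_eq_mul]
  obtain ⟨A, hA⟩ : ∃ A, A ∉ 𝓢.biUnion fun S => bad₁ S ∪ bad₂ S := by
    by_contra! h
    rw [Finset.eq_univ_iff_forall.2 h, sum_binomialWeight] at hbad
    exact lt_irrefl _ hbad
  have hA1 : ∀ S ∈ 𝓢, A ∉ bad₁ S ∧ A ∉ bad₂ S := fun S hS => by
    have : ¬ A ∈ bad₁ S ∪ bad₂ S := fun h => hA (Finset.mem_biUnion.2 ⟨S, hS, h⟩)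
    rwa [Finset.mem_union, not_or] at this
  refine exists_subset_hitting h3 (t := t) (A := A) (fun S hS => ?_)
    fun S hS 𝓕 h𝓕 hcard hdisj hsub => ?_
  · simpa [hbad₁] using (hA1 S hS).1
  · exact (hA1 S hS).2 (Finset.mem_filter.2
      ⟨Finset.mem_univ _, 𝓕, h𝓕, hcard, hdisj, hsub⟩)

end RandomSubset

/-- The edge set of the triangle with vertices `a`, `b`, `c`. -/
def triangleEdges {V : Type*} [DecidableEq V] (a b c : V) : Finset (Sym2 V) :=
  {s(a, b), s(b, c), s(a, c)}

theorem card_triangleEdges {V : Type*} [DecidableEq V] {a b c : V} (hab : a ≠ b) (hbc : b ≠ c)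
    (hac : a ≠ c) : (triangleEdges a b c).card = 3 := by
  refine Finset.card_eq_three.2 ⟨_, _, _, ?_, ?_, ?_, rfl⟩ <;>
    simp only [Ne, Sym2.eq_iff] <;> grind

theorem exists_triangleEdges_eq {V : Type*} [DecidableEq V] {a b c x y : V}
    (h : s(x, y) ∈ triangleEdges a b c) : ∃ z, triangleEdges x y z = triangleEdges a b c := by
  simp only [triangleEdges, Finset.mem_insert, Finset.mem_singleton, Sym2.eq_iff] at h
  rcases h with (⟨rfl, rfl⟩ | ⟨rfl, rfl⟩) | (⟨rfl, rfl⟩ | ⟨rfl, rfl⟩) | (⟨rfl, rfl⟩ | ⟨rfl, rfl⟩)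
  · exact ⟨c, rfl⟩
  · refine ⟨c, ?_⟩
    ext e
    simp only [triangleEdges, Finset.mem_insert, Finset.mem_singleton, Sym2.eq_swap (a := x)]
    tauto
  · refine ⟨a, ?_⟩
    ext e
    simp only [triangleEdges, Finset.mem_insert, Finset.mem_singleton, Sym2.eq_swap (b := a)]
    tauto
  · refine ⟨a, ?_⟩
    ext e
    simp only [triangleEdges, Finset.mem_insert, Finset.mem_singleton, Sym2.eq_swap (b := a),
      Sym2.eq_swap (a := x) (b := y)]
    tauto
  · refine ⟨b, ?_⟩
    ext e
    simp only [triangleEdges, Finset.mem_insert, Finset.mem_singleton, Sym2.eq_swap (a := y)]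
    tauto
  · refine ⟨b, ?_⟩
    ext e
    simp only [triangleEdges, Finset.mem_insert, Finset.mem_singleton, Sym2.eq_swap (a := x)]
    tauto

theorem not_ramseyProp_of_lt_one {β : Type*} [Fintype β] {G : SimpleGraph β} {m n t : ℕ} {p : ℝ}
    (hG : G.edgeSet.ncard = m) (h0 : 0 ≤ p) (h1 : p ≤ 1) (hn : 1 ≤ n)
    (hlt : (n : ℝ) ^ n *
      (2 ^ (3 * t) * (1 - p / 2) ^ m + (m * n).choose t * p ^ (3 * t)) < 1) :
    ¬ RamseyProp n (⊤ : SimpleGraph (Fin 3)) G := by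
  classical
  set 𝒯 : Finset (Finset (Sym2 (Fin n))) := Finset.univ.filter fun T =>
    ∃ a b c, a ≠ b ∧ b ≠ c ∧ a ≠ c ∧ T = triangleEdges a b c with h𝒯
  set 𝓢 : Finset (Finset (Sym2 (Fin n))) :=
    Finset.univ.image fun φ : β ↪ Fin n => G.edgeFinset.image (Sym2.map φ) with h𝓢
  have hcard : 𝓢.card ≤ n ^ n := by
    refine Finset.card_image_le.trans ?_
    rw [Finset.card_univ, Fintype.card_embedding_eq, Fintype.card_fin]
    rcases le_or_gt (Fintype.card β) n with h | h
    · exact (Nat.descFactorial_le_pow n _).trans (Nat.pow_le_pow_right hn h)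
    · rw [Nat.descFactorial_of_lt h]
      exact Nat.zero_le _
  have hp : 0 ≤ 1 - p / 2 := by linarith
  obtain ⟨B, hB𝒯, hB𝓢⟩ := exists_hitting h0 h1 (𝒯 := 𝒯) (𝓢 := 𝓢) (D := n) (m := m) (t := t)
    (by
      intro T hT
      obtain ⟨a, b, c, hab, hbc, hac, rfl⟩ := (Finset.mem_filter.1 hT).2
      exact card_triangleEdges hab hbc hac)
    (by
      intro e
      induction e using Sym2.ind with | _ x y =>
      calc (𝒯.filter fun T => s(x, y) ∈ T).card
          ≤ (Finset.univ.image fun z : Fin n => triangleEdges x y z).card := by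
            refine Finset.card_le_card fun T hT => ?_
            obtain ⟨hT, hxy⟩ := Finset.mem_filter.1 hT
            obtain ⟨a, b, c, -, -, -, rfl⟩ := (Finset.mem_filter.1 hT).2
            obtain ⟨z, hz⟩ := exists_triangleEdges_eq hxy
            exact Finset.mem_image.2 ⟨z, Finset.mem_univ z, hz⟩
        _ ≤ n := Finset.card_image_le.trans (by simp))
    (by
      intro S hS
      obtain ⟨φ, -, rfl⟩ := Finset.mem_image.1 hS
      rw [Finset.card_image_of_injective _ (Sym2.map.injective φ.injective), ← hG,
        ← coe_edgeFinset, Set.ncard_coe_finset])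
    (by
      refine lt_of_le_of_lt ?_ hlt
      gcongr
      exact_mod_cast hcard)
  intro h
  rcases h (fromEdgeSet (B : Set (Sym2 (Fin n)))) with hc | ⟨f, hf⟩
  · refine not_containsCopy_of_triangleFree (fun a b c hab hbc hac => ?_) hc
    rw [fromEdgeSet_adj] at hab hbc hac
    refine hB𝒯 (triangleEdges a b c) (Finset.mem_filter.2
      ⟨Finset.mem_univ _, a, b, c, hab.2, hbc.2, hac.2, rfl⟩) fun e he => ?_
    simp only [triangleEdges, Finset.mem_insert, Finset.mem_singleton] at he
    rcases he with rfl | rfl | rfl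
    · exact hab.1
    · exact hbc.1
    · exact hac.1
  · obtain ⟨e, he⟩ := hB𝓢 _ (Finset.mem_image_of_mem _ (Finset.mem_univ (⟨f, hf⟩ : β ↪ Fin n)))
    obtain ⟨heS, heB⟩ := Finset.mem_inter.1 he
    obtain ⟨e, heG, rfl⟩ := Finset.mem_image.1 heS
    induction e using Sym2.ind with | _ x y =>
    have hxy : G.Adj x y := by simpa using heG
    have hadj := f.map_adj hxy
    rw [compl_adj, fromEdgeSet_adj] at hadj
    exact hadj.2 ⟨heB, hadj.1⟩

theorem choose_mul_pow_le {N t : ℕ} {q c : ℝ} (ht : 0 < t) (hq : 0 ≤ q)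
    (h : Real.exp 1 * (N * q) ≤ c * t) : (N.choose t : ℝ) * q ^ t ≤ c ^ t := by
  have ht' : (0 : ℝ) < t := by exact_mod_cast ht
  have h1 : (t : ℝ) ^ t / t.factorial ≤ Real.exp 1 ^ t := by
    rw [← Real.exp_nat_mul, mul_one]
    exact Real.pow_div_factorial_le_exp _ ht'.le t
  have h2 : (N.choose t : ℝ) ≤ (N : ℝ) ^ t / t.factorial := Nat.choose_le_pow_div t N
  have hf : (0 : ℝ) < t.factorial := by exact_mod_cast t.factorial_pos
  refine le_of_mul_le_mul_right ?_ (pow_pos ht' t)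
  calc (N.choose t : ℝ) * q ^ t * t ^ t ≤ (N : ℝ) ^ t / t.factorial * q ^ t * t ^ t := by gcongr
    _ = (N * q) ^ t * ((t : ℝ) ^ t / t.factorial) := by rw [mul_pow]; ring
    _ ≤ (N * q) ^ t * Real.exp 1 ^ t := by gcongr
    _ = (Real.exp 1 * (N * q)) ^ t := by rw [mul_pow (Real.exp 1)]; ring
    _ ≤ (c * t) ^ t := by gcongr
    _ = c ^ t * t ^ t := mul_pow _ _ _

theorem not_ramseyProp {β : Type*} [Fintype β] {G : SimpleGraph β} {m n : ℕ}
    (hG : G.edgeSet.ncard = m) (hm : 2 ≤ m) (hn : 1 ≤ n)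
    (h : n * √n * Real.log m ≤ m / 10000) :
    ¬ RamseyProp n (⊤ : SimpleGraph (Fin 3)) G := by
  have hn' : (1 : ℝ) ≤ n := by exact_mod_cast hn
  have hm' : (2 : ℝ) ≤ m := by exact_mod_cast hm
  have hlog : 0.69 ≤ Real.log m := by
    have := Real.log_le_log (by norm_num) hm'
    linarith [Real.log_two_gt_d9]
  have hs1 : 1 ≤ √(n : ℝ) := Real.one_le_sqrt.2 hn'
  have hss : √(n : ℝ) ^ 2 = n := Real.sq_sqrt (by linarith)
  set s := √(n : ℝ) with hs
  have hs0 : 0 < s := by linarith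
  set p : ℝ := 1 / (200 * s) with hp
  have hp0 : 0 < p := by positivity
  have hp1 : p ≤ 1 := by
    rw [hp, div_le_one (by positivity)]
    linarith
  have hps : p ^ 2 * n = 1 / 40000 := by
    rw [← hss, hp]
    field_simp
    norm_num
  set u := p * m with hu
  have hu1 : 50 * (n * Real.log m) ≤ u := by
    rw [hu, hp, one_div_mul_eq_div, le_div_iff₀ (by positivity)]
    linarith
  have hnlog : 0.69 ≤ n * Real.log m := by nlinarith
  have hu2 : 34 ≤ u := by linarith
  have hnm : (n : ℝ) ≤ m := by
    have h1 : (n : ℝ) * 1 * 0.69 ≤ n * s * Real.log m := by gcongr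
    linarith
  set t := ⌊u / 12⌋₊ with ht
  have ht1 : (t : ℝ) ≤ u / 12 := Nat.floor_le (by linarith)
  have ht2 : u / 24 ≤ t := by
    have := Nat.lt_floor_add_one (u / 12)
    rw [← ht] at this
    linarith
  have ht0 : 0 < t := by
    have : (0 : ℝ) < t := by linarith
    exact_mod_cast this
  refine not_ramseyProp_of_lt_one hG hp0.le hp1 hn (t := t) ?_
  have hexp1 : (2 : ℝ) ≤ Real.exp 1 := by linarith [Real.exp_one_gt_d9]
  have hpp : 0 ≤ 1 - p / 2 := by linarith
  have hb1 : 2 ^ (3 * t) * (1 - p / 2) ^ m ≤ Real.exp (-(u / 4)) := by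
    calc (2 : ℝ) ^ (3 * t) * (1 - p / 2) ^ m
        ≤ Real.exp 1 ^ (3 * t) * Real.exp (-(p / 2)) ^ m := by
          gcongr
          linarith [Real.add_one_le_exp (-(p / 2))]
      _ = Real.exp (3 * t - u / 2) := by
          rw [← Real.exp_nat_mul, ← Real.exp_nat_mul, ← Real.exp_add]
          congr 1
          push_cast
          rw [hu]
          ring
      _ ≤ Real.exp (-(u / 4)) := by
          rw [Real.exp_le_exp]
          linarith
  have hb2 : ((m * n).choose t : ℝ) * p ^ (3 * t) ≤ Real.exp (-(u / 4)) := by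
    rw [pow_mul]
    calc ((m * n).choose t : ℝ) * (p ^ 3) ^ t ≤ Real.exp (-6) ^ t := by
          refine choose_mul_pow_le ht0 (by positivity) ?_
          have h1 : ((m * n : ℕ) : ℝ) * p ^ 3 = u / 40000 := by
            push_cast
            calc (m : ℝ) * n * p ^ 3 = (p ^ 2 * n) * (p * m) := by ring
              _ = u / 40000 := by rw [hps, ← hu]; ring
          have h7 : Real.exp 7 ≤ 1600 := by
            calc Real.exp 7 = Real.exp 1 ^ 7 := by rw [← Real.exp_nat_mul]; norm_num
              _ ≤ 2.72 ^ 7 := by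
                gcongr
                linarith [Real.exp_one_lt_d9]
              _ ≤ 1600 := by norm_num
          have h6 : Real.exp 1 = Real.exp 7 * Real.exp (-6) := by
            rw [← Real.exp_add]; norm_num
          rw [h1, h6]
          have hpos := Real.exp_pos (-6)
          calc Real.exp 7 * Real.exp (-6) * (u / 40000)
              = Real.exp (-6) * (Real.exp 7 * (u / 40000)) := by ring
            _ ≤ Real.exp (-6) * (1600 * (u / 40000)) := by gcongr
            _ ≤ Real.exp (-6) * t := by
                gcongr
                linarith
      _ = Real.exp (-6 * t) := by rw [← Real.exp_nat_mul]; ring_nf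
      _ ≤ Real.exp (-(u / 4)) := by
          rw [Real.exp_le_exp]
          linarith
  have hb3 : (n : ℝ) ^ n ≤ Real.exp (u / 50) := by
    calc (n : ℝ) ^ n = Real.exp (n * Real.log n) := by
          rw [Real.exp_nat_mul, Real.exp_log (by linarith)]
      _ ≤ Real.exp (u / 50) := by
          rw [Real.exp_le_exp]
          have : n * Real.log n ≤ n * Real.log m := by gcongr
          linarith
  calc (n : ℝ) ^ n * (2 ^ (3 * t) * (1 - p / 2) ^ m + (m * n).choose t * p ^ (3 * t))
      ≤ Real.exp (u / 50) * (Real.exp (-(u / 4)) + Real.exp (-(u / 4))) := by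
        gcongr
    _ = 2 * Real.exp (u / 50 - u / 4) := by
        rw [sub_eq_add_neg, Real.exp_add]
        ring
    _ ≤ Real.exp 1 * Real.exp (u / 50 - u / 4) := by gcongr
    _ = Real.exp (1 + (u / 50 - u / 4)) := by rw [← Real.exp_add]
    _ < 1 := by
        rw [Real.exp_lt_one_iff]
        linarith

theorem le_ramseyNumber {β : Type*} [Fintype β] {G : SimpleGraph β} {m : ℕ}
    (hG : G.edgeSet.ncard = m) (hm : 2 ≤ m) :
    1 / 1000 * (m : ℝ) ^ ((2 : ℝ) / 3) / Real.log m ^ ((2 : ℝ) / 3) ≤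
      ramseyNumber (⊤ : SimpleGraph (Fin 3)) G := by
  have hm' : (2 : ℝ) ≤ m := by exact_mod_cast hm
  have hlog : 0 < Real.log m := Real.log_pos (by linarith)
  set X := 1 / 1000 * (m : ℝ) ^ ((2 : ℝ) / 3) / Real.log m ^ ((2 : ℝ) / 3) with hX
  have hX0 : 0 ≤ X := by positivity
  have hcube : ∀ y : ℝ, 0 < y → (y ^ ((2 : ℝ) / 3)) ^ 3 = y ^ 2 := fun y hy => by
    rw [← Real.rpow_natCast, ← Real.rpow_mul hy.le, ← Real.rpow_natCast]
    norm_num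
  have hX3 : X ^ 3 = 1 / 10 ^ 9 * m ^ 2 / Real.log m ^ 2 := by
    rw [hX, div_pow, mul_pow, hcube m (by linarith), hcube _ hlog]
    norm_num
  refine (Nat.lt_floor_add_one X).le.trans ?_
  suffices h : ⌊X⌋₊ < ramseyNumber (⊤ : SimpleGraph (Fin 3)) G by exact_mod_cast h
  rcases Nat.eq_zero_or_pos ⌊X⌋₊ with h | hn
  · rw [h]
    exact (Nat.sInf_mem (exists_ramseyProp G)).1
  · refine lt_ramseyNumber (not_ramseyProp hG hm hn ?_)
    have hnX : (⌊X⌋₊ : ℝ) ≤ X := Nat.floor_le hX0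
    refine le_of_sq_le_sq ?_ (by positivity)
    rw [mul_pow, mul_pow, Real.sq_sqrt (by positivity)]
    calc (⌊X⌋₊ : ℝ) ^ 2 * ⌊X⌋₊ * Real.log m ^ 2 = (⌊X⌋₊ : ℝ) ^ 3 * Real.log m ^ 2 := by ring
      _ ≤ X ^ 3 * Real.log m ^ 2 := by gcongr
      _ = 1 / 10 ^ 9 * m ^ 2 := by
          rw [hX3]
          field_simp
      _ ≤ (m / 10000) ^ 2 := by
          have : (0 : ℝ) < m ^ 2 := by positivity
          rw [div_pow]
          linarith

theorem stmt_15 :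
    ∃ c₁ c₂ : ℝ, 0 < c₁ ∧ 0 < c₂ ∧
      (∀ (β : Type) [Fintype β] (G : SimpleGraph β) (m : ℕ),
        G.edgeSet.ncard = m → 2 ≤ m →
        c₁ * (m : ℝ) ^ ((2 : ℝ) / 3) / Real.log m ^ ((2 : ℝ) / 3) ≤
          ramseyNumber (⊤ : SimpleGraph (Fin 3)) G) ∧
      ∃ M : ℕ, ∀ m : ℕ, M ≤ m →
        ∃ (β : Type) (_ : Fintype β) (G : SimpleGraph β),
          G.edgeSet.ncard = m ∧
          (ramseyNumber (⊤ : SimpleGraph (Fin 3)) G : ℝ) ≤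
            c₂ * (m : ℝ) ^ ((2 : ℝ) / 3) / Real.log m ^ ((1 : ℝ) / 3) := by
  refine ⟨1 / 1000, 128, by norm_num, by norm_num, ?_, 2 ^ 15, ?_⟩
  · intro β _ G m hG hm
    exact le_ramseyNumber hG hm
  · intro m hm
    exact exists_graph_ramseyNumber_le hm
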